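/- Lemma (growth of derivatives along periodic orbits). Let 𝒩⁰, 𝒥 and T : 𝒥 → [0,1] satisfy conditions (1)–(3), and for q ≥ 1 let e_q denote the supremum of |I| over all connected components I of ⋂_{k=0}^{q−1} T^{−k}(𝒥). Then there exists a constant C_d > 0 such that every periodic orbit x₀, x₁ = T(x₀), …, x_q = x₀ of T with minimal period q satisfies |DT^q(x₀)| ≥ C_d / e_q. -/

import Mathlib

open MeasureTheory Set Filter

noncomputable section

/-- The setting of Mañé's theorem for induced maps: a family `𝒩⁰` of pairwise disjoint
compact subintervals of `(0,1)` with nonempty interior, and a map `T : 𝒥 → [0,1]`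
(`𝒥 = ⋃ 𝒩⁰`) such that: (1) `T` restricted to each `J ∈ 𝒩⁰` is a `C¹` diffeomorphism
onto `[0,1]`; (2) `T` has `D_d`-bounded distortion on each `J ∈ 𝒩⁰`; (3) every periodic
orbit of `T` (of minimal period `q`) is hyperbolic repelling. -/
structure InducedSetup where
  /-- the family `𝒩⁰` of intervals -/
  Nfam : Set (Set ℝ)
  /-- the induced map, given as a global map whose relevant values are those on `𝒥` -/
  T : ℝ → ℝ
  /-- the distortion constant `D_d` -/
  Dd : ℝ
  hN : ∀ J ∈ Nfam, IsCompact J ∧ J.OrdConnected ∧ (interior J).Nonempty ∧ J ⊆ Set.Ioo 0 1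
  hdisj : Nfam.Pairwise Disjoint
  hdiffeo : ∀ J ∈ Nfam, Set.BijOn T J (Set.Icc 0 1) ∧
    (∀ x ∈ J, DifferentiableAt ℝ T x ∧ deriv T x ≠ 0) ∧ ContinuousOn (deriv T) J
  hDd : 0 < Dd
  hdist : ∀ J ∈ Nfam, ∀ x ∈ J, ∀ y ∈ J, deriv T x / deriv T y ≤ 1 + Dd * |T x - T y|
  hper : ∀ (x : ℝ) (q : ℕ), 1 ≤ q → (∀ k < q, T^[k] x ∈ ⋃₀ Nfam) → T^[q] x = x →
    (∀ k, 0 < k → k < q → T^[k] x ≠ x) →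
    1 < |∏ k ∈ Finset.range q, deriv T (T^[k] x)|

/-- The domain `𝒥 = ⋃_{J ∈ 𝒩⁰} J` of the induced map. -/
def InducedSetup.J (S : InducedSetup) : Set ℝ := ⋃₀ S.Nfam

/-- The derivative `DT^n` of the `n`-th iterate of `T`, written via the chain rule as
the product of the derivatives of `T` along the orbit. -/
noncomputable def derIter (T : ℝ → ℝ) (n : ℕ) (x : ℝ) : ℝ :=
  ∏ k ∈ Finset.range n, deriv T (T^[k] x)

/-- The set `⋂_{k=0}^{n-1} T^{-k}(𝒥)` of points whose first `n` iterates stay in `𝒥`. -/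
def InducedSetup.inter (S : InducedSetup) (n : ℕ) : Set ℝ :=
  ⋂ k ∈ Finset.range n, S.T^[k] ⁻¹' S.J

/-- `e_n`: the supremum of the lengths of the connected components of
`⋂_{k=0}^{n-1} T^{-k}(𝒥)`. -/
noncomputable def InducedSetup.eN (S : InducedSetup) (n : ℕ) : ℝ :=
  sSup ((fun x => (volume (connectedComponentIn (S.inter n) x)).toReal) '' S.inter n)


/-! ### Real-variable preliminaries -/

lemma strictMonoOn_or_strictAntiOn_of_hasDerivAt_ne_zero {f f' : ℝ → ℝ} {s : Set ℝ}
    (hs : s.OrdConnected) (hf : ∀ x ∈ s, HasDerivAt f (f' x) x) (h0 : ∀ x ∈ s, f' x ≠ 0) :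
    StrictMonoOn f s ∨ StrictAntiOn f s := by
  have hc : ContinuousOn f s := fun x hx => (hf x hx).continuousAt.continuousWithinAt
  rcases hasDerivWithinAt_forall_lt_or_forall_gt_of_forall_ne hs.convex
    (fun x hx => (hf x hx).hasDerivWithinAt) h0 with h | h
  · right
    refine strictAntiOn_of_deriv_neg hs.convex hc fun x hx => ?_
    rw [(hf x (interior_subset hx)).deriv]
    exact h x (interior_subset hx)
  · left
    refine strictMonoOn_of_deriv_pos hs.convex hc fun x hx => ?_
    rw [(hf x (interior_subset hx)).deriv]
    exact h x (interior_subset hx)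

lemma sum_sub_le_one_of_disjoint_Icc {ι : Type*} (s : Finset ι) (a b : ι → ℝ)
    (hab : ∀ i ∈ s, a i ≤ b i) (ha : ∀ i ∈ s, 0 ≤ a i) (hb : ∀ i ∈ s, b i ≤ 1)
    (hd : (s : Set ι).PairwiseDisjoint fun i => Icc (a i) (b i)) :
    ∑ i ∈ s, (b i - a i) ≤ 1 := by
  have h1 : volume (⋃ i ∈ s, Icc (a i) (b i)) ≤ volume (Icc (0 : ℝ) 1) :=
    measure_mono (iUnion₂_subset fun i hi => Icc_subset_Icc (ha i hi) (hb i hi))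
  rw [measure_biUnion_finset hd fun i _ => measurableSet_Icc] at h1
  simp only [Real.volume_Icc, sub_zero] at h1
  rw [← ENNReal.ofReal_sum_of_nonneg fun i hi => sub_nonneg.2 (hab i hi)] at h1
  exact (ENNReal.ofReal_le_ofReal_iff zero_le_one).1 h1

/-- If no marker `u j` lies in the segment attached to another marker `u i`, then the segments
lying on one side of their markers are pairwise disjoint, so the total length is at most `2`. -/
lemma sum_abs_sub_le_two {ι : Type*} (s : Finset ι) (u v : ι → ℝ)
    (hu : ∀ i ∈ s, u i ∈ Icc (0 : ℝ) 1) (hv : ∀ i ∈ s, v i ∈ Icc (0 : ℝ) 1)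
    (h : ∀ i ∈ s, ∀ j ∈ s, u j ∈ uIcc (u i) (v i) → j = i) :
    ∑ i ∈ s, |v i - u i| ≤ 2 := by
  classical
  rw [← Finset.sum_filter_add_sum_filter_not s (fun i => u i ≤ v i)]
  have h1 : ∑ i ∈ s with u i ≤ v i, |v i - u i| ≤ 1 := by
    rw [Finset.sum_congr rfl fun i hi => abs_of_nonneg (sub_nonneg.2 (Finset.mem_filter.1 hi).2)]
    refine sum_sub_le_one_of_disjoint_Icc _ u v (fun i hi => (Finset.mem_filter.1 hi).2)
      (fun i hi => (hu i (Finset.mem_filter.1 hi).1).1)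
      (fun i hi => (hv i (Finset.mem_filter.1 hi).1).2) ?_
    intro i hi j hj hij
    simp only [Finset.coe_filter, mem_ofPred_eq] at hi hj
    refine Set.disjoint_left.2 fun z hz hz' => hij ?_
    rcases le_total (u i) (u j) with hle | hle
    · refine (h i hi.1 j hj.1 ?_).symm
      rw [uIcc_of_le hi.2]
      exact ⟨hle, hz'.1.trans hz.2⟩
    · refine h j hj.1 i hi.1 ?_
      rw [uIcc_of_le hj.2]
      exact ⟨hle, hz.1.trans hz'.2⟩
  have h2 : ∑ i ∈ s with ¬ u i ≤ v i, |v i - u i| ≤ 1 := by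
    have hlt : ∀ i ∈ s.filter (fun i => ¬ u i ≤ v i), v i ≤ u i := fun i hi =>
      (not_le.1 (Finset.mem_filter.1 hi).2).le
    rw [Finset.sum_congr rfl fun i hi => (abs_sub_comm _ _).trans
      (abs_of_nonneg (sub_nonneg.2 (hlt i hi)))]
    refine sum_sub_le_one_of_disjoint_Icc _ v u hlt
      (fun i hi => (hv i (Finset.mem_filter.1 hi).1).1)
      (fun i hi => (hu i (Finset.mem_filter.1 hi).1).2) ?_
    intro i hi j hj hij
    simp only [Finset.coe_filter, mem_ofPred_eq, not_le] at hi hj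
    refine Set.disjoint_left.2 fun z hz hz' => hij ?_
    rcases le_total (u i) (u j) with hle | hle
    · refine h j hj.1 i hi.1 ?_
      rw [uIcc_of_ge hj.2.le]
      exact ⟨hz'.1.trans hz.2, hle⟩
    · refine (h i hi.1 j hj.1 ?_).symm
      rw [uIcc_of_ge hi.2.le]
      exact ⟨hz.1.trans hz'.2, hle⟩
  linarith

lemma sum_range_le_three_of_doubling (d : ℕ → ℝ) (n : ℕ) (h0 : ∀ k, 0 ≤ d k)
    (h1 : ∀ k < n, d k ≤ 1) (h2 : ∀ k, k + 2 < n → 2 * d k ≤ d (k + 1)) :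
    ∑ k ∈ Finset.range n, d k ≤ 3 := by
  have key : ∀ r, r + 1 < n → ∑ k ∈ Finset.range (r + 1), d k ≤ 2 * d r := by
    intro r
    induction r with
    | zero => intro _; simp; linarith [h0 0]
    | succ r ih =>
      intro hr
      rw [Finset.sum_range_succ]
      linarith [ih (by omega), h2 r (by omega)]
  rcases n with _ | _ | n
  · simp
  · simp; linarith [h1 0 (by omega)]
  · rw [Finset.sum_range_succ]
    linarith [key n (by omega), h1 n (by omega), h1 (n + 1) (by omega)]

/-! ### The derivative cocycle -/

lemma derIter_add (T : ℝ → ℝ) (m n : ℕ) (x : ℝ) :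
    derIter T (m + n) x = derIter T m x * derIter T n (T^[m] x) := by
  simp only [derIter, Finset.prod_range_add]
  congr 1
  refine Finset.prod_congr rfl fun k _ => ?_
  rw [add_comm m k, Function.iterate_add_apply]

lemma derIter_iterate_of_periodic {T : ℝ → ℝ} {q : ℕ} {x : ℝ} (hx : T^[q] x = x) {i : ℕ}
    (h0 : derIter T i x ≠ 0) : derIter T q (T^[i] x) = derIter T q x := by
  have h := derIter_add T i q x
  rw [add_comm, derIter_add, hx, mul_comm] at h
  exact (mul_left_cancel₀ h0 h).symm

namespace InducedSetup

variable (S : InducedSetup)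

/-! ### Single branches -/

variable {S} in
lemma hasDerivAt_of_mem {J : Set ℝ} (hJ : J ∈ S.Nfam) {x : ℝ} (hx : x ∈ J) :
    HasDerivAt S.T (deriv S.T x) x :=
  ((S.hdiffeo J hJ).2.1 x hx).1.hasDerivAt

variable {S} in
lemma branch_monotone_or_antitone {J : Set ℝ} (hJ : J ∈ S.Nfam) :
    MonotoneOn S.T J ∨ AntitoneOn S.T J :=
  (strictMonoOn_or_strictAntiOn_of_hasDerivAt_ne_zero (S.hN J hJ).2.1
    (fun _ hx => hasDerivAt_of_mem hJ hx) fun x hx => ((S.hdiffeo J hJ).2.1 x hx).2).imp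
    StrictMonoOn.monotoneOn StrictAntiOn.antitoneOn

variable {S} in
lemma abs_deriv_le {J : Set ℝ} (hJ : J ∈ S.Nfam) {x y : ℝ} (hx : x ∈ J) (hy : y ∈ J) :
    |deriv S.T x| ≤ (1 + S.Dd * |S.T x - S.T y|) * |deriv S.T y| := by
  have h0 := fun x hx => ((S.hdiffeo J hJ).2.1 x hx).2
  have hpos : 0 < |deriv S.T y| := abs_pos.2 (h0 y hy)
  rw [← div_le_iff₀ hpos, ← abs_div, abs_of_pos]
  · exact S.hdist J hJ x hx y hy
  · rcases hasDerivWithinAt_forall_lt_or_forall_gt_of_forall_ne (S.hN J hJ).2.1.convex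
      (fun x hx => (hasDerivAt_of_mem hJ hx).hasDerivWithinAt) h0 with h | h
    · exact div_pos_of_neg_of_neg (h x hx) (h y hy)
    · exact div_pos (h x hx) (h y hy)

/-- A set on which the induced map expands by a factor of at least two. -/
def Expanding (J : Set ℝ) : Prop := ∀ x ∈ J, 2 ≤ |deriv S.T x|

variable {S} in
lemma two_mul_abs_sub_le {J : Set ℝ} (hJ : J ∈ S.Nfam) (hE : S.Expanding J) {x y : ℝ}
    (hx : x ∈ J) (hy : y ∈ J) : 2 * |x - y| ≤ |S.T x - S.T y| := by
  wlog hxy : y < x generalizing x y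
  · rcases (not_lt.1 hxy).eq_or_lt with rfl | h
    · simp
    · rw [abs_sub_comm, abs_sub_comm (S.T x)]
      exact this hy hx h
  have hsub : Icc y x ⊆ J := (S.hN J hJ).2.1.out hy hx
  obtain ⟨c, hc, hc'⟩ := exists_hasDerivAt_eq_slope S.T (deriv S.T) hxy
    (fun z hz => (hasDerivAt_of_mem hJ (hsub hz)).continuousAt.continuousWithinAt)
    (fun z hz => hasDerivAt_of_mem hJ (hsub (Ioo_subset_Icc_self hz)))
  have h := hE c (hsub (Ioo_subset_Icc_self hc))
  have hpos : 0 < |x - y| := abs_pos.2 (sub_pos.2 hxy).ne'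
  rwa [hc', abs_div, le_div_iff₀ hpos] at h

variable {S} in
lemma volume_ge_of_not_expanding {J : Set ℝ} (hJ : J ∈ S.Nfam) (hE : ¬ S.Expanding J) :
    ENNReal.ofReal (1 / (2 * (1 + S.Dd))) ≤ volume J := by
  simp only [Expanding, not_forall, not_le] at hE
  obtain ⟨w, hw, hw2⟩ := hE
  have hD := S.hDd
  obtain ⟨a, ha, ha0⟩ := (S.hdiffeo J hJ).1.surjOn (show (0 : ℝ) ∈ Icc (0 : ℝ) 1 by simp)
  obtain ⟨b, hb, hb1⟩ := (S.hdiffeo J hJ).1.surjOn (show (1 : ℝ) ∈ Icc (0 : ℝ) 1 by simp)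
  have hbound : ∀ z ∈ J, ‖deriv S.T z‖ ≤ 2 * (1 + S.Dd) := by
    intro z hz
    have h1 := abs_deriv_le hJ hz hw
    have hz' := (S.hdiffeo J hJ).1.mapsTo hz
    have hw' := (S.hdiffeo J hJ).1.mapsTo hw
    have h2 : |S.T z - S.T w| ≤ 1 := by
      rw [abs_le]; constructor <;> linarith [hz'.1, hz'.2, hw'.1, hw'.2]
    rw [Real.norm_eq_abs]
    have h3 : S.Dd * |S.T z - S.T w| ≤ S.Dd := mul_le_of_le_one_right hD.le h2
    have h4 : 0 ≤ S.Dd * |S.T z - S.T w| := by positivity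
    nlinarith [abs_nonneg (deriv S.T w)]
  have hmv := (S.hN J hJ).2.1.convex.norm_image_sub_le_of_norm_hasDerivWithin_le
    (fun z hz => (hasDerivAt_of_mem hJ hz).hasDerivWithinAt) hbound ha hb
  rw [ha0, hb1] at hmv
  simp only [sub_zero, norm_one, Real.norm_eq_abs] at hmv
  have hle : 1 / (2 * (1 + S.Dd)) ≤ |b - a| := by
    rw [div_le_iff₀ (by positivity)]; linarith
  calc ENNReal.ofReal (1 / (2 * (1 + S.Dd))) ≤ ENNReal.ofReal |b - a| :=
        ENNReal.ofReal_le_ofReal hle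
    _ = volume (uIcc a b) := Real.volume_interval.symm
    _ ≤ volume J := measure_mono ((S.hN J hJ).2.1.uIcc_subset ha hb)

lemma finite_not_expanding : {J ∈ S.Nfam | ¬ S.Expanding J}.Finite := by
  have hD := S.hDd
  have hfin := Measure.finite_const_le_meas_of_disjoint_iUnion₀ (μ := volume)
    (ι := S.Nfam) (ε := ENNReal.ofReal (1 / (2 * (1 + S.Dd))))
    (by rw [ENNReal.ofReal_pos]; positivity) (As := fun J => (J : Set ℝ))
    (fun J => (S.hN J J.2).1.measurableSet.nullMeasurableSet)
    (fun J K hJK => (S.hdisj J.2 K.2 (Subtype.coe_injective.ne hJK)).aedisjoint)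
    (ne_top_of_le_ne_top (measure_ne_top_of_subset subset_rfl (by simp : volume (Icc (0:ℝ) 1) ≠ ⊤))
      (measure_mono (iUnion_subset fun J => (S.hN J J.2).2.2.2.trans Ioo_subset_Icc_self)))
  refine (hfin.image Subtype.val).subset ?_
  rintro J ⟨hJ, hE⟩
  exact ⟨⟨J, hJ⟩, volume_ge_of_not_expanding hJ hE, rfl⟩

/-- The finitely many non-expanding branches stay away from the endpoints of `[0,1]`. -/
lemma exists_margin : ∃ c : ℝ, 0 < c ∧ c ≤ 1 ∧ ∀ J ∈ S.Nfam, ¬ S.Expanding J →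
    ∀ x ∈ J, c ≤ x ∧ x ≤ 1 - c := by
  have hK : IsCompact (⋃₀ {J ∈ S.Nfam | ¬ S.Expanding J}) :=
    S.finite_not_expanding.isCompact_sUnion fun J hJ => (S.hN J hJ.1).1
  have hsub : ⋃₀ {J ∈ S.Nfam | ¬ S.Expanding J} ⊆ Ioo 0 1 :=
    sUnion_subset fun J hJ => (S.hN J hJ.1).2.2.2
  rcases (⋃₀ {J ∈ S.Nfam | ¬ S.Expanding J}).eq_empty_or_nonempty with he | hne
  · refine ⟨1, one_pos, le_rfl, fun J hJ hE x hx => ?_⟩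
    have hx' : x ∈ ⋃₀ {J ∈ S.Nfam | ¬ S.Expanding J} := mem_sUnion_of_mem hx ⟨hJ, hE⟩
    rw [he] at hx'
    exact hx'.elim
  · obtain ⟨a, ha⟩ := hK.exists_isLeast hne
    obtain ⟨b, hb⟩ := hK.exists_isGreatest hne
    have ha' := hsub ha.1
    have hb' := hsub hb.1
    refine ⟨min a (1 - b), lt_min ha'.1 (sub_pos.2 hb'.2), (min_le_left _ _).trans ha'.2.le,
      fun J hJ hE x hx => ?_⟩
    have hx' : x ∈ ⋃₀ {J ∈ S.Nfam | ¬ S.Expanding J} := mem_sUnion_of_mem hx ⟨hJ, hE⟩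
    have h1 := ha.2 hx'
    have h2 := hb.2 hx'
    exact ⟨(min_le_left _ _).trans h1, by linarith [min_le_right a (1 - b)]⟩

/-! ### Cylinders -/

/-- Two points visit the same branches during the first `n` steps. -/
def SameBranch (n : ℕ) (x y : ℝ) : Prop :=
  ∀ k < n, ∃ J ∈ S.Nfam, S.T^[k] x ∈ J ∧ S.T^[k] y ∈ J

variable {S} {m n : ℕ} {x y z : ℝ}

lemma sameBranch_self_of_mem (h : ∀ k < n, S.T^[k] x ∈ S.J) : S.SameBranch n x x := by
  intro k hk
  obtain ⟨J, hJ, hx⟩ := h k hk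
  exact ⟨J, hJ, hx, hx⟩

lemma branch_unique {J K : Set ℝ} (hJ : J ∈ S.Nfam) (hK : K ∈ S.Nfam) (hx : x ∈ J)
    (hx' : x ∈ K) : J = K := by
  by_contra h
  exact Set.disjoint_left.1 (S.hdisj hJ hK h) hx hx'

namespace SameBranch

lemma symm (h : S.SameBranch n x y) : S.SameBranch n y x := fun k hk => by
  obtain ⟨J, hJ, h1, h2⟩ := h k hk
  exact ⟨J, hJ, h2, h1⟩

lemma trans (h : S.SameBranch n x y) (h' : S.SameBranch n y z) : S.SameBranch n x z :=
  fun k hk => by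
    obtain ⟨J, hJ, h1, h2⟩ := h k hk
    obtain ⟨K, hK, h3, h4⟩ := h' k hk
    obtain rfl := branch_unique hJ hK h2 h3
    exact ⟨J, hJ, h1, h4⟩

lemma right (h : S.SameBranch n x y) : S.SameBranch n y y := h.symm.trans h

lemma mono (h : S.SameBranch n x y) (hmn : m ≤ n) : S.SameBranch m x y :=
  fun k hk => h k (hk.trans_le hmn)

lemma mem_J (h : S.SameBranch n x y) {k : ℕ} (hk : k < n) : S.T^[k] y ∈ S.J := by
  obtain ⟨J, hJ, -, h2⟩ := h k hk
  exact ⟨J, hJ, h2⟩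

lemma iterate (h : S.SameBranch (m + n) x y) : S.SameBranch n (S.T^[m] x) (S.T^[m] y) :=
  fun k hk => by
    simpa only [← Function.iterate_add_apply, add_comm k m] using h (m + k) (by omega)

lemma append (h : S.SameBranch m x y) (h' : S.SameBranch n (S.T^[m] x) (S.T^[m] y)) :
    S.SameBranch (m + n) x y := fun k hk => by
  rcases lt_or_ge k m with hkm | hkm
  · exact h k hkm
  · obtain ⟨j, rfl⟩ := Nat.exists_eq_add_of_le hkm
    simpa only [← Function.iterate_add_apply, add_comm j m] using h' j (by omega)

lemma succ_iff {J : Set ℝ} (hJ : J ∈ S.Nfam) (hx : x ∈ J) :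
    S.SameBranch (n + 1) x y ↔ y ∈ J ∧ S.SameBranch n (S.T x) (S.T y) := by
  constructor
  · intro h
    obtain ⟨K, hK, h1, h2⟩ := h 0 (by omega)
    obtain rfl := branch_unique hJ hK hx h1
    exact ⟨h2, (show S.SameBranch (1 + n) x y by rwa [add_comm]).iterate⟩
  · rintro ⟨hy, h⟩
    rw [add_comm]
    refine append (fun k hk => ?_) h
    obtain rfl : k = 0 := by omega
    exact ⟨J, hJ, hx, hy⟩

lemma iterate_succ_mem_Icc (h : S.SameBranch n x y) {k : ℕ} (hk : k < n) :
    S.T^[k + 1] y ∈ Icc (0 : ℝ) 1 := by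
  obtain ⟨J, hJ, -, h2⟩ := h k hk
  rw [Function.iterate_succ_apply']
  exact (S.hdiffeo J hJ).1.mapsTo h2

lemma hasDerivAt (h : S.SameBranch n x x) : HasDerivAt S.T^[n] (derIter S.T n x) x := by
  induction n with
  | zero => simpa [derIter] using hasDerivAt_id x
  | succ n ih =>
    obtain ⟨J, hJ, h1, -⟩ := h n (by omega)
    rw [Function.iterate_succ', derIter, Finset.prod_range_succ, mul_comm]
    exact (hasDerivAt_of_mem hJ h1).comp x (ih (h.mono (by omega)))

lemma derIter_ne_zero (h : S.SameBranch n x x) : derIter S.T n x ≠ 0 := by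
  refine Finset.prod_ne_zero_iff.2 fun k hk => ?_
  obtain ⟨J, hJ, h1, -⟩ := h k (Finset.mem_range.1 hk)
  exact ((S.hdiffeo J hJ).2.1 _ h1).2

lemma abs_derIter_le (h : S.SameBranch n x y) {A : ℝ}
    (hA : ∑ k ∈ Finset.range n, |S.T^[k + 1] x - S.T^[k + 1] y| ≤ A) :
    |derIter S.T n x| ≤ Real.exp (S.Dd * A) * |derIter S.T n y| := by
  have h1 : |derIter S.T n x| ≤
      Real.exp (S.Dd * ∑ k ∈ Finset.range n, |S.T^[k + 1] x - S.T^[k + 1] y|) *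
        |derIter S.T n y| := by
    rw [Finset.mul_sum, Real.exp_sum, derIter, derIter, Finset.abs_prod, Finset.abs_prod,
      ← Finset.prod_mul_distrib]
    refine Finset.prod_le_prod (fun _ _ => abs_nonneg _) fun k hk => ?_
    obtain ⟨J, hJ, hx, hy⟩ := h k (Finset.mem_range.1 hk)
    refine (abs_deriv_le hJ hx hy).trans ?_
    rw [Function.iterate_succ_apply', Function.iterate_succ_apply']
    gcongr
    rw [add_comm]
    exact Real.add_one_le_exp _
  refine h1.trans ?_
  have := S.hDd
  gcongr

end SameBranch

/-- The part of the cylinder of order `n` around `x` that is mapped into `B` by `T^n`. -/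
def pullback (S : InducedSetup) (n : ℕ) (x : ℝ) (B : Set ℝ) : Set ℝ :=
  {y | S.SameBranch n x y ∧ S.T^[n] y ∈ B}

lemma pullback_succ {J B : Set ℝ} (hJ : J ∈ S.Nfam) (hx : x ∈ J) :
    S.pullback (n + 1) x B = J ∩ S.T ⁻¹' S.pullback n (S.T x) B := by
  ext y
  change _ ∧ _ ↔ _ ∧ _ ∧ _
  rw [SameBranch.succ_iff hJ hx, and_assoc]
  rfl

lemma pullback_spec {B : Set ℝ} (hB : B.OrdConnected) (hB1 : B ⊆ Icc 0 1)
    (hx : S.SameBranch n x x) :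
    (S.pullback n x B).OrdConnected ∧ S.pullback n x B ⊆ Icc 0 1 ∧
      SurjOn S.T^[n] (S.pullback n x B) B := by
  induction n generalizing x with
  | zero =>
    have : S.pullback 0 x B = B := by
      ext y
      exact ⟨fun h => h.2, fun h => ⟨fun k hk => by omega, h⟩⟩
    rw [this]
    exact ⟨hB, hB1, surjOn_id B⟩
  | succ n ih =>
    obtain ⟨J, hJ, hxJ, -⟩ := hx 0 (by omega)
    change x ∈ J at hxJ
    obtain ⟨h1, h2, h3⟩ := ih ((SameBranch.succ_iff hJ hxJ).1 hx).2
    rw [pullback_succ hJ hxJ]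
    refine ⟨?_, fun y hy => Ioo_subset_Icc_self ((S.hN J hJ).2.2.2 hy.1), fun b hb => ?_⟩
    · have hJo := (S.hN J hJ).2.1
      refine ⟨fun a ha b hb c hc => ⟨hJo.out ha.1 hb.1 hc, ?_⟩⟩
      have hcJ := hJo.out ha.1 hb.1 hc
      rcases branch_monotone_or_antitone hJ with hm | hm
      · exact h1.out ha.2 hb.2 ⟨hm ha.1 hcJ hc.1, hm hcJ hb.1 hc.2⟩
      · exact h1.out hb.2 ha.2 ⟨hm hcJ hb.1 hc.2, hm ha.1 hcJ hc.1⟩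
    · obtain ⟨a, ha, rfl⟩ := h3 hb
      obtain ⟨w, hw, rfl⟩ := (S.hdiffeo J hJ).1.surjOn (h2 ha)
      exact ⟨w, ⟨hw, ha⟩, by rw [Function.iterate_succ_apply]⟩

lemma abs_sub_le_eN {q : ℕ} (hq : 1 ≤ q) {W : Set ℝ} (hW : W.OrdConnected)
    (hWi : W ⊆ S.inter q) (hx : x ∈ W) (hy : y ∈ W) : |x - y| ≤ S.eN q := by
  have hsub : S.inter q ⊆ Icc 0 1 := by
    intro z hz
    have : S.T^[0] z ∈ S.J := mem_iInter₂.1 hz 0 (Finset.mem_range.2 (by omega))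
    obtain ⟨J, hJ, hzJ⟩ := this
    exact Ioo_subset_Icc_self ((S.hN J hJ).2.2.2 hzJ)
  have hvol : ∀ z, volume (connectedComponentIn (S.inter q) z) ≤ 1 := fun z =>
    (measure_mono ((connectedComponentIn_subset _ _).trans hsub)).trans (by simp)
  have hle : |x - y| ≤ (volume (connectedComponentIn (S.inter q) x)).toReal := by
    rw [← ENNReal.ofReal_le_iff_le_toReal (ne_top_of_le_ne_top ENNReal.one_ne_top (hvol x)),
      abs_sub_comm, ← Real.volume_interval]
    exact measure_mono ((hW.uIcc_subset hx hy).trans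
      ((isPreconnected_iff_ordConnected.2 hW).subset_connectedComponentIn hx hWi))
  refine hle.trans (le_csSup ⟨1, ?_⟩ ⟨x, hWi hx, rfl⟩)
  rintro _ ⟨z, -, rfl⟩
  exact ENNReal.toReal_le_of_le_ofReal zero_le_one (by simpa using hvol z)

lemma ordConnected_iterate_image {A : Set ℝ} (hA : A.OrdConnected)
    (h : ∀ y ∈ A, S.SameBranch n y y) : (S.T^[n] '' A).OrdConnected :=
  isPreconnected_iff_ordConnected.1 <| (isPreconnected_iff_ordConnected.2 hA).image _
    fun y hy => (h y hy).hasDerivAt.continuousAt.continuousWithinAt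

/-! ### Distortion along a cylinder -/

/-- Distortion on a cylinder all of whose intermediate branches, apart from the first and the last
one, are expanding. -/
lemma abs_derIter_le_of_expanding
    (hE : ∀ j, 1 ≤ j → j + 1 < n → ∃ J ∈ S.Nfam, S.Expanding J ∧ S.T^[j] x ∈ J)
    (hy : S.SameBranch n x y) (hz : S.SameBranch n x z) :
    |derIter S.T n y| ≤ Real.exp (S.Dd * 3) * |derIter S.T n z| := by
  refine (hy.symm.trans hz).abs_derIter_le
    (sum_range_le_three_of_doubling _ n (fun _ => abs_nonneg _) (fun k hk => ?_) fun k hk => ?_)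
  · have h1 := hy.iterate_succ_mem_Icc hk
    have h2 := hz.iterate_succ_mem_Icc hk
    rw [abs_le]
    constructor <;> linarith [h1.1, h1.2, h2.1, h2.2]
  · obtain ⟨J, hJ, hJE, hx⟩ := hE (k + 1) (by omega) (by omega)
    obtain ⟨K, hK, h1, h2⟩ := hy (k + 1) (by omega)
    obtain ⟨L, hL, h3, h4⟩ := hz (k + 1) (by omega)
    obtain rfl := branch_unique hJ hK hx h1
    obtain rfl := branch_unique hJ hL hx h3
    rw [Function.iterate_succ_apply' _ (k + 1), Function.iterate_succ_apply' _ (k + 1)]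
    exact two_mul_abs_sub_le hJ hJE h2 h4

/-- If `U` meets the periodic orbit of `x` only at `x`, then the pullbacks of `U` along the orbit
each contain a single orbit point, so that their total length is bounded. -/
lemma sum_abs_sub_le_two_of_pullback {q : ℕ} (hv : S.SameBranch q x x) (hxq : S.T^[q] x = x)
    (hmin : ∀ k, 0 < k → k < q → S.T^[k] x ≠ x) {U : Set ℝ} (hU : U.OrdConnected)
    (hU1 : U ⊆ Icc 0 1) (hxU : x ∈ U) (hO : ∀ k, S.T^[k] x ∈ U → S.T^[k] x = x)
    (hz : z ∈ S.pullback q x U) :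
    ∑ k ∈ Finset.range q, |S.T^[k + 1] z - S.T^[k + 1] x| ≤ 2 := by
  have hA := (pullback_spec hU hU1 hv).1
  have hxA : x ∈ S.pullback q x U := ⟨hv, by rwa [hxq]⟩
  refine sum_abs_sub_le_two _ (fun k => S.T^[k + 1] x) (fun k => S.T^[k + 1] z)
    (fun k hk => hv.iterate_succ_mem_Icc (Finset.mem_range.1 hk))
    (fun k hk => hz.1.iterate_succ_mem_Icc (Finset.mem_range.1 hk)) fun i hi j hj hij => ?_
  rw [Finset.mem_range] at hi hj
  have himg : (S.T^[i + 1] '' S.pullback q x U).OrdConnected :=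
    ordConnected_iterate_image hA fun y hy => hy.1.right.mono (by omega)
  obtain ⟨w, hw, hwj⟩ := himg.uIcc_subset (mem_image_of_mem _ hxA) (mem_image_of_mem _ hz) hij
  have hret : S.T^[q - (i + 1) + (j + 1)] x = x := by
    apply hO
    rw [Function.iterate_add_apply, ← hwj, ← Function.iterate_add_apply,
      Nat.sub_add_cancel (by omega)]
    exact hw.2
  by_contra hne
  rcases lt_or_gt_of_ne hne with hlt | hlt
  · exact hmin _ (by omega) (by omega) hret
  · rw [show q - (i + 1) + (j + 1) = (j - i) + q by omega, Function.iterate_add_apply, hxq] at hret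
    exact hmin _ (by omega) (by omega) hret

/-! ### A window around a suitable point of the orbit -/

lemma exists_not_mem_common_expanding {J : Set ℝ} (hJ : J ∈ S.Nfam) (hx : x ∈ J) (hy : y ∈ J)
    (hxy : x ≠ y) :
    ∃ j, 1 ≤ j ∧ ¬ ∃ K ∈ S.Nfam, S.Expanding K ∧ S.T^[j] x ∈ K ∧ S.T^[j] y ∈ K := by
  by_contra! hcon
  have hne : 0 < |S.T x - S.T y| :=
    abs_pos.2 (sub_ne_zero.2 fun h => hxy ((S.hdiffeo J hJ).1.injOn hx hy h))
  have hgrow : ∀ k, 2 ^ k * |S.T x - S.T y| ≤ |S.T^[k + 1] x - S.T^[k + 1] y| := by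
    intro k
    induction k with
    | zero => simp
    | succ k ih =>
      obtain ⟨K, hK, hKE, h1, h2⟩ := hcon (k + 1) (by omega)
      have h := two_mul_abs_sub_le hK hKE h1 h2
      rw [Function.iterate_succ_apply' _ (k + 1), Function.iterate_succ_apply' _ (k + 1), pow_succ]
      linarith
  obtain ⟨k, hk⟩ := pow_unbounded_of_one_lt (1 / |S.T x - S.T y|) (one_lt_two (α := ℝ))
  rw [div_lt_iff₀ hne] at hk
  obtain ⟨K, hK, -, h1, h2⟩ := hcon (k + 1) (by omega)
  have h1 := (S.hN K hK).2.2.2 h1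
  have h2 := (S.hN K hK).2.2.2 h2
  have h3 : |S.T^[k + 1] x - S.T^[k + 1] y| < 1 := by
    rw [abs_lt]
    constructor <;> linarith [h1.1, h1.2, h2.1, h2.2]
  linarith [hgrow k]

/-- An interval `U` around `x` that meets the orbit of `x` only at `x`, and whose image under some
iterate `T^n` has length at least `c`, where all branches visited by `x` strictly between the first
and the last of these `n` steps are expanding. -/
structure IsWindow (S : InducedSetup) (c : ℝ) (x : ℝ) (n : ℕ) (U : Set ℝ) : Prop where
  ordConnected : U.OrdConnected
  subset_Icc : U ⊆ Icc 0 1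
  mem : x ∈ U
  sameBranch : ∀ y ∈ U, S.SameBranch n x y
  orbit : ∀ k, S.T^[k] x ∈ U → S.T^[k] x = x
  large : ∃ a ∈ U, ∃ b ∈ U, c ≤ |S.T^[n] a - S.T^[n] b|
  expanding : ∀ j, 1 ≤ j → j + 1 < n → ∃ J ∈ S.Nfam, S.Expanding J ∧ S.T^[j] x ∈ J

lemma isWindow_cylinder {c : ℝ} (hc : c ≤ 1) (hv : S.SameBranch (n + 1) x x)
    (hO : ∀ k, S.SameBranch (n + 1) x (S.T^[k] x) → S.T^[k] x = x)
    (hE : ∀ j, 1 ≤ j → j < n → ∃ J ∈ S.Nfam, S.Expanding J ∧ S.T^[j] x ∈ J) :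
    S.IsWindow c x (n + 1) (S.pullback (n + 1) x (Icc 0 1)) := by
  obtain ⟨h1, h2, h3⟩ := pullback_spec ordConnected_Icc subset_rfl hv
  refine ⟨h1, h2, ⟨hv, hv.iterate_succ_mem_Icc (by omega)⟩, fun y hy => hy.1,
    fun k hk => hO k hk.1, ?_, fun j hj hj' => hE j hj (by omega)⟩
  obtain ⟨a, ha, ha0⟩ := h3 (show (0 : ℝ) ∈ Icc (0 : ℝ) 1 by simp)
  obtain ⟨b, hb, hb1⟩ := h3 (show (1 : ℝ) ∈ Icc (0 : ℝ) 1 by simp)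
  exact ⟨a, ha, b, hb, by rw [ha0, hb1]; simpa using hc⟩

/-- A point of the cylinder of `x` on the left of `x` that is mapped to an endpoint of `[0,1]`. -/
lemma exists_lt_iterate_mem_endpoints (hv : S.SameBranch n x x)
    (hx : S.T^[n] x ∈ Ioo (0 : ℝ) 1) :
    ∃ a ∈ S.pullback n x (Icc 0 1), a < x ∧ (S.T^[n] a = 0 ∨ S.T^[n] a = 1) := by
  obtain ⟨h1, h2, h3⟩ := pullback_spec ordConnected_Icc subset_rfl hv
  obtain ⟨a, ha, ha0⟩ := h3 (show (0 : ℝ) ∈ Icc (0 : ℝ) 1 by simp)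
  obtain ⟨b, hb, hb1⟩ := h3 (show (1 : ℝ) ∈ Icc (0 : ℝ) 1 by simp)
  have hxC : x ∈ S.pullback n x (Icc 0 1) := ⟨hv, Ioo_subset_Icc_self hx⟩
  rcases strictMonoOn_or_strictAntiOn_of_hasDerivAt_ne_zero h1
    (fun y hy => hy.1.right.hasDerivAt) (fun y hy => hy.1.right.derIter_ne_zero) with hm | hm
  · exact ⟨a, ha, (hm.lt_iff_lt ha hxC).1 (ha0 ▸ hx.1), Or.inl ha0⟩
  · exact ⟨b, hb, (hm.lt_iff_gt hxC hb).1 (hb1 ▸ hx.2), Or.inr hb1⟩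

lemma exists_isWindow {c : ℝ} (hc1 : c ≤ 1)
    (hc : ∀ J ∈ S.Nfam, ¬ S.Expanding J → ∀ x ∈ J, c ≤ x ∧ x ≤ 1 - c)
    (hv : ∀ n, S.SameBranch n x x) (hfin : (range fun k => S.T^[k] x).Finite) {J : Set ℝ}
    (hJ : J ∈ S.Nfam) (hxJ : x ∈ J) (hmin : ∀ k, S.T^[k] x ∈ J → x ≤ S.T^[k] x) :
    ∃ n U, S.IsWindow c x n U := by
  set Q : Set ℝ := (range fun k => S.T^[k] x) ∩ (J \ {x})
  rcases Q.eq_empty_or_nonempty with hemp | hne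
  · refine ⟨_, _, isWindow_cylinder (n := 0) hc1 (hv _) (fun k hk => ?_)
      fun j hj hj' => by omega⟩
    by_contra hk'
    have : S.T^[k] x ∈ Q := ⟨⟨k, rfl⟩, ((SameBranch.succ_iff hJ hxJ).1 hk).1, hk'⟩
    rw [hemp] at this
    exact this.elim
  obtain ⟨y, ⟨⟨l, rfl⟩, hyJ, hyx⟩, hymin⟩ :=
    (hfin.subset inter_subset_left : Q.Finite).isCompact.exists_isLeast hne
  set y := S.T^[l] x
  have hxy : x < y := lt_of_le_of_ne (hmin l hyJ) (Ne.symm hyx)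
  have hnext : ∀ k, S.T^[k] x ∈ J → S.T^[k] x < y → S.T^[k] x = x := by
    intro k hk hlt
    by_contra hkx
    exact absurd (hymin ⟨⟨k, rfl⟩, hk, hkx⟩) (not_le.2 hlt)
  have hex := exists_not_mem_common_expanding hJ hxJ hyJ hxy.ne
  classical
  obtain ⟨m, ⟨hm1, hm⟩, hlt⟩ : ∃ m, (1 ≤ m ∧ ¬ ∃ K ∈ S.Nfam, S.Expanding K ∧ S.T^[m] x ∈ K ∧
      S.T^[m] y ∈ K) ∧ ∀ j < m, 1 ≤ j → ∃ K ∈ S.Nfam, S.Expanding K ∧ S.T^[j] x ∈ K ∧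
      S.T^[j] y ∈ K :=
    ⟨Nat.find hex, Nat.find_spec hex, fun j hj hj1 => by
      by_contra h
      exact Nat.find_min hex hj ⟨hj1, h⟩⟩
  have hE : ∀ j, 1 ≤ j → j < m → ∃ K ∈ S.Nfam, S.Expanding K ∧ S.T^[j] x ∈ K := by
    intro j hj hjm
    obtain ⟨K, hK, hKE, h1, -⟩ := hlt j hjm hj
    exact ⟨K, hK, hKE, h1⟩
  have hsame : S.SameBranch m x y := by
    intro k hk
    rcases Nat.eq_zero_or_pos k with rfl | hk0
    · exact ⟨J, hJ, hxJ, hyJ⟩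
    · obtain ⟨K, hK, -, h1, h2⟩ := hlt k hk hk0
      exact ⟨K, hK, h1, h2⟩
  have hsubJ : ∀ n, 1 ≤ n → ∀ z, S.SameBranch n x z → z ∈ J := fun n hn z hz =>
    ((SameBranch.succ_iff (n := 0) hJ hxJ).1 (hz.mono hn)).1
  by_cases hcase : ∃ K ∈ S.Nfam, S.T^[m] x ∈ K ∧ S.T^[m] y ∈ K
  · obtain ⟨K, hK, hxK, hyK⟩ := hcase
    have hKE : ¬ S.Expanding K := fun h => hm ⟨K, hK, h, hxK, hyK⟩
    have hxm := (S.hN K hK).2.2.2 hxK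
    obtain ⟨a, ha, hax, ha'⟩ := exists_lt_iterate_mem_endpoints (hv m) hxm
    obtain ⟨h1, h2, -⟩ := pullback_spec (S := S) ordConnected_Icc subset_rfl (hv m)
    have hxU : x ∈ S.pullback m x (Icc 0 1) ∩ Iio y := ⟨⟨hv m, Ioo_subset_Icc_self hxm⟩, hxy⟩
    refine ⟨m, S.pullback m x (Icc 0 1) ∩ Iio y, h1.inter ordConnected_Iio,
      inter_subset_left.trans h2, hxU, fun z hz => hz.1.1,
      fun k hk => hnext k (hsubJ m hm1 _ hk.1.1) hk.2, ?_, fun j hj hj' => hE j hj (by omega)⟩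
    refine ⟨x, hxU, a, ⟨ha, hax.trans hxy⟩, ?_⟩
    have hmar := hc K hK hKE _ hxK
    rcases ha' with h | h <;> rw [h]
    · exact le_abs.2 (Or.inl (by linarith))
    · exact le_abs.2 (Or.inr (by linarith))
  · refine ⟨_, _, isWindow_cylinder (n := m) hc1 (hv _) (fun k hk => ?_) hE⟩
    refine hnext k (hsubJ (m + 1) (by omega) _ hk) (not_le.1 fun hle => hcase ?_)
    have hord := (pullback_spec (S := S) ordConnected_Icc subset_rfl (hv (m + 1))).1
    have hmem : y ∈ S.pullback (m + 1) x (Icc 0 1) :=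
      hord.out ⟨hv _, (hv _).iterate_succ_mem_Icc m.lt_succ_self⟩
        ⟨hk, hk.iterate_succ_mem_Icc m.lt_succ_self⟩ ⟨hxy.le, hle⟩
    exact hmem.1 m (by omega)

/-! ### The growth estimate -/

lemma le_eN_mul_of_isWindow {c : ℝ} {q : ℕ} (hq : 1 ≤ q) (hv : ∀ n, S.SameBranch n x x)
    (hxq : S.T^[q] x = x) (hmin : ∀ k, 0 < k → k < q → S.T^[k] x ≠ x) {U : Set ℝ}
    (hU : S.IsWindow c x n U) :
    c ≤ Real.exp (S.Dd * 5) * (S.eN q * |derIter S.T q x|) := by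
  obtain ⟨hA, -, hsurj⟩ := pullback_spec hU.ordConnected hU.subset_Icc (hv q)
  set A := S.pullback q x U
  have hlong : ∀ z ∈ A, S.SameBranch (q + n) x z := fun z hz =>
    hz.1.append (by rw [hxq]; exact hU.sameBranch _ hz.2)
  have hW : (S.T^[n] '' A).OrdConnected :=
    ordConnected_iterate_image hA fun z hz => (hlong z hz).right.mono (by omega)
  have hWq : ∀ w ∈ S.T^[n] '' A, S.SameBranch q w w := by
    rintro _ ⟨z, hz, rfl⟩
    exact (show S.SameBranch (n + q) z z by
      rw [add_comm]; exact (hlong z hz).right).iterate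
  have hbound : ∀ w ∈ S.T^[n] '' A,
      ‖derIter S.T q w‖ ≤ Real.exp (S.Dd * 5) * |derIter S.T q x| := by
    rintro _ ⟨z, hz, rfl⟩
    have hzn : S.SameBranch n x z := (hlong z hz).mono (by omega)
    have h1 : |derIter S.T q z| ≤ Real.exp (S.Dd * 2) * |derIter S.T q x| :=
      hz.1.symm.abs_derIter_le (sum_abs_sub_le_two_of_pullback (hv q) hxq hmin hU.ordConnected
        hU.subset_Icc hU.mem hU.orbit hz)
    have h2 := abs_derIter_le_of_expanding hU.expanding (hU.sameBranch _ hz.2) hzn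
    have hpos : 0 < |derIter S.T n z| := abs_pos.2 hzn.right.derIter_ne_zero
    have h3 : |derIter S.T n z| * |derIter S.T q (S.T^[n] z)| =
        |derIter S.T q z| * |derIter S.T n (S.T^[q] z)| := by
      rw [← abs_mul, ← abs_mul, ← derIter_add, ← derIter_add, add_comm]
    rw [Real.norm_eq_abs, ← mul_le_mul_iff_right₀ hpos, h3]
    calc |derIter S.T q z| * |derIter S.T n (S.T^[q] z)|
        ≤ (Real.exp (S.Dd * 2) * |derIter S.T q x|) *
          (Real.exp (S.Dd * 3) * |derIter S.T n z|) := by gcongr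
      _ = |derIter S.T n z| * (Real.exp (S.Dd * 5) * |derIter S.T q x|) := by
        rw [show S.Dd * 5 = S.Dd * 2 + S.Dd * 3 by ring, Real.exp_add]; ring
  obtain ⟨a, ha, b, hb, hab⟩ := hU.large
  obtain ⟨a', ha', rfl⟩ := hsurj ha
  obtain ⟨b', hb', rfl⟩ := hsurj hb
  have hmv := hW.convex.norm_image_sub_le_of_norm_hasDerivWithin_le
    (fun w hw => (hWq w hw).hasDerivAt.hasDerivWithinAt) hbound (mem_image_of_mem _ hb')
    (mem_image_of_mem _ ha')
  have hlen := abs_sub_le_eN hq hW (fun w hw => mem_iInter₂.2 fun k hk =>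
    (hWq w hw).mem_J (Finset.mem_range.1 hk)) (mem_image_of_mem _ ha') (mem_image_of_mem _ hb')
  simp only [Real.norm_eq_abs, ← Function.iterate_add_apply] at hmv hab
  rw [add_comm n q] at hab
  calc c ≤ _ := hab
    _ ≤ _ := hmv
    _ ≤ Real.exp (S.Dd * 5) * |derIter S.T q x| * S.eN q := by
      gcongr
    _ = _ := by ring

end InducedSetup

/-- **Lemma (growth of derivatives along periodic orbits).** Under conditions (1)–(3),
there is `C_d > 0` such that every periodic orbit `x₀, …, x_q = x₀` of `T` with minimal
period `q` satisfies `|DT^q(x₀)| ≥ C_d / e_q`, i.e. `C_d ≤ e_q · |DT^q(x₀)|`. -/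
theorem periodic_derivative_growth (S : InducedSetup) :
    ∃ Cd > (0 : ℝ), ∀ (x : ℝ) (q : ℕ), 1 ≤ q →
      (∀ k < q, S.T^[k] x ∈ S.J) → S.T^[q] x = x →
      (∀ k, 0 < k → k < q → S.T^[k] x ≠ x) →
      Cd ≤ S.eN q * |derIter S.T q x| := by
  obtain ⟨c, hc0, hc1, hc⟩ := S.exists_margin
  refine ⟨c / Real.exp (S.Dd * 5), by positivity, fun x q hq hJ hxq hmin => ?_⟩
  rw [div_le_iff₀' (Real.exp_pos _)]
  have hper : Function.IsPeriodicPt S.T q x := hxq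
  have hmod : ∀ k, S.T^[k % q] x = S.T^[k] x := hper.iterate_mod_apply
  have hv : ∀ n, S.SameBranch n x x := fun n => InducedSetup.sameBranch_self_of_mem fun k _ => by
    rw [← hmod]
    exact hJ _ (Nat.mod_lt _ hq)
  have hfin : (range fun k => S.T^[k] x).Finite := by
    refine ((Finset.range q).finite_toSet.image fun k => S.T^[k] x).subset ?_
    rintro _ ⟨k, rfl⟩
    exact ⟨k % q, Finset.mem_coe.2 (Finset.mem_range.2 (Nat.mod_lt _ hq)), hmod k⟩
  obtain ⟨J, hJN, hxJ⟩ : ∃ J ∈ S.Nfam, x ∈ J := hJ 0 hq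
  obtain ⟨_, ⟨⟨i, rfl⟩, hiJ⟩, hleast⟩ :=
    (hfin.subset inter_subset_left : ((range fun k => S.T^[k] x) ∩ J).Finite).isCompact
      |>.exists_isLeast ⟨x, ⟨0, rfl⟩, hxJ⟩
  have hshift : ∀ k, S.T^[k] (S.T^[i] x) = S.T^[k + i] x := fun k =>
    (Function.iterate_add_apply _ _ _ _).symm
  have hv' : ∀ n, S.SameBranch n (S.T^[i] x) (S.T^[i] x) := fun n => (hv (i + n)).iterate
  have hfin' : (range fun k => S.T^[k] (S.T^[i] x)).Finite := by
    refine hfin.subset ?_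
    rintro _ ⟨k, rfl⟩
    exact ⟨k + i, (hshift k).symm⟩
  obtain ⟨n, U, hU⟩ := InducedSetup.exists_isWindow hc1 hc hv' hfin' hJN hiJ fun k hk =>
    hleast ⟨⟨k + i, (hshift k).symm⟩, hk⟩
  have hxq' : S.T^[q] (S.T^[i] x) = S.T^[i] x := hper.apply_iterate i
  have hmin' : ∀ k, 0 < k → k < q → S.T^[k] (S.T^[i] x) ≠ S.T^[i] x := by
    intro k hk hkq h
    refine hmin k hk hkq ?_
    have h' := congrArg S.T^[i * q - i] h
    rw [hshift, ← Function.iterate_add_apply, ← Function.iterate_add_apply,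
      show i * q - i + (k + i) = k + i * q by have := Nat.le_mul_of_pos_right i hq; omega,
      show i * q - i + i = i * q by have := Nat.le_mul_of_pos_right i hq; omega,
      Function.iterate_add_apply, (hper.const_mul i).eq] at h'
    exact h'
  have h := InducedSetup.le_eN_mul_of_isWindow hq hv' hxq' hmin' hU
  rwa [derIter_iterate_of_periodic hxq (hv i).derIter_ne_zero] at h
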